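/- (Invariance of the Bouncy Hybrid Sampler with generalized refreshment.) Let U : ℝ^d → ℝ be continuously differentiable with ∫ e^{-U(x)} dx < ∞, let g : ℝ^d → ℝ^d be continuous with g(x) ≠ 0 for all x, let λ₀ ≥ 0 and φ ∈ (0, π/2], and for each x let R(x) v = v - 2 (⟨v, g(x)⟩ / ‖g(x)‖²) g(x). Then for every smooth compactly supported f : ℝ^d × ℝ^d → ℝ, ∫∫ [ ⟨∇_x f(x,v), v⟩ + ⟨∇_v f(x,v), -∇U(x) + g(x)⟩ + max{0, ⟨v, g(x)⟩} (f(x, R(x) v) - f(x,v)) + λ₀ ( ∫ f(x, cos(φ) v + sin(φ) ξ) ψ_d(ξ) dξ - f(x,v) ) ] e^{-U(x)} ψ_d(v) dx dv = 0. -/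

import Mathlib

open scoped InnerProductSpace
open MeasureTheory

/-- The standard Gaussian density on `ℝ^d`. -/
noncomputable def gaussDensity (d : ℕ) (v : EuclideanSpace ℝ (Fin d)) : ℝ :=
  (2 * Real.pi) ^ (-(d : ℝ) / 2) * Real.exp (-‖v‖ ^ 2 / 2)

lemma HasCompactSupport.comp_of_leftInverse {X Y M : Type*} [TopologicalSpace X] [R1Space X]
    [TopologicalSpace Y] [Zero M] {F : Y → M} (hF : HasCompactSupport F) {i : X → Y} {p : Y → X}
    (hp : Continuous p) (h : Function.LeftInverse p i) : HasCompactSupport fun x => F (i x) :=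
  .intro (hF.isCompact.image hp) fun x hx => image_eq_zero_of_notMem_tsupport fun hm =>
    hx ⟨i x, hm, h x⟩

section GaussDensity

variable {d : ℕ}

lemma integral_gaussDensity : ∫ v : EuclideanSpace ℝ (Fin d), gaussDensity d v = 1 := by
  have h := GaussianFourier.integral_rexp_neg_mul_sq_norm (V := EuclideanSpace ℝ (Fin d))
    (b := 1 / 2) (by norm_num)
  have hexp (v : EuclideanSpace ℝ (Fin d)) : -‖v‖ ^ 2 / 2 = -(1 / 2) * ‖v‖ ^ 2 := by ring
  simp only [gaussDensity, integral_const_mul, hexp, h, finrank_euclideanSpace_fin]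
  rw [show Real.pi / (1 / 2) = 2 * Real.pi by ring, ← Real.rpow_add (by positivity), neg_div,
    neg_add_cancel, Real.rpow_zero]

lemma integrable_gaussDensity : Integrable (gaussDensity d) :=
  .of_integral_ne_zero (by rw [integral_gaussDensity]; exact one_ne_zero)

lemma contDiff_gaussDensity {n : WithTop ℕ∞} : ContDiff ℝ n (gaussDensity d) := by
  have h : ContDiff ℝ n (fun v : EuclideanSpace ℝ (Fin d) => ‖v‖ ^ 2) := contDiff_norm_sq ℝ
  exact contDiff_const.mul (Real.contDiff_exp.comp (h.neg.div_const 2))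

lemma continuous_gaussDensity : Continuous (gaussDensity d) :=
  (contDiff_gaussDensity (n := 0)).continuous

lemma fderiv_gaussDensity_apply (v b : EuclideanSpace ℝ (Fin d)) :
    fderiv ℝ (gaussDensity d) v b = -(⟪v, b⟫_ℝ * gaussDensity d v) := by
  have h : HasFDerivAt (fun v : EuclideanSpace ℝ (Fin d) => -‖v‖ ^ 2 / 2) _ v :=
    ((hasStrictFDerivAt_norm_sq v).hasFDerivAt.neg.mul_const (2⁻¹ : ℝ))
  have h' : HasFDerivAt (gaussDensity d) _ v :=
    h.exp.const_mul ((2 * Real.pi) ^ (-(d : ℝ) / 2))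
  rw [h'.fderiv]
  simp [gaussDensity]
  ring

lemma gaussDensity_mul_rotation (v ξ : EuclideanSpace ℝ (Fin d)) (φ : ℝ) :
    gaussDensity d (Real.cos φ • v + Real.sin φ • ξ)
      * gaussDensity d (-Real.sin φ • v + Real.cos φ • ξ)
      = gaussDensity d v * gaussDensity d ξ := by
  have h : -‖Real.cos φ • v + Real.sin φ • ξ‖ ^ 2 / 2
      + -‖-Real.sin φ • v + Real.cos φ • ξ‖ ^ 2 / 2 = -‖v‖ ^ 2 / 2 + -‖ξ‖ ^ 2 / 2 := by
    simp only [norm_add_sq_real, norm_smul, inner_smul_left, inner_smul_right, mul_pow,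
      Real.norm_eq_abs, sq_abs]
    simp
    linear_combination (-‖v‖ ^ 2 / 2 - ‖ξ‖ ^ 2 / 2) * Real.sin_sq_add_cos_sq φ
  simp only [gaussDensity]
  rw [mul_mul_mul_comm, ← Real.exp_add, h, Real.exp_add, mul_mul_mul_comm]

/-- Rotations of `V × V` mixing the two factors preserve Lebesgue measure. -/
lemma measurePreserving_prod_rotation {V : Type*} [NormedAddCommGroup V] [InnerProductSpace ℝ V]
    [FiniteDimensional ℝ V] [MeasurableSpace V] [BorelSpace V] (φ : ℝ) :
    MeasurePreserving (fun z : V × V =>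
      (Real.cos φ • z.1 + Real.sin φ • z.2, -Real.sin φ • z.1 + Real.cos φ • z.2)) := by
  let A : WithLp 2 (V × V) →ₗ[ℝ] WithLp 2 (V × V) :=
    { toFun := fun z => WithLp.toLp 2
        (Real.cos φ • z.fst + Real.sin φ • z.snd, -Real.sin φ • z.fst + Real.cos φ • z.snd)
      map_add' := fun z w => by
        refine WithLp.ofLp_injective _ (Prod.ext ?_ ?_) <;> simp <;> module
      map_smul' := fun a z => by
        refine WithLp.ofLp_injective _ (Prod.ext ?_ ?_) <;> simp <;> module }
  have hA (z : WithLp 2 (V × V)) : ‖A z‖ = ‖z‖ := by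
    rw [← sq_eq_sq₀ (norm_nonneg _) (norm_nonneg _), WithLp.prod_norm_sq_eq_of_L2,
      WithLp.prod_norm_sq_eq_of_L2]
    change ‖Real.cos φ • z.fst + Real.sin φ • z.snd‖ ^ 2
      + ‖-Real.sin φ • z.fst + Real.cos φ • z.snd‖ ^ 2 = _
    simp only [norm_add_sq_real, norm_smul, inner_smul_left, inner_smul_right, mul_pow,
      Real.norm_eq_abs, sq_abs]
    simp
    linear_combination (‖z.fst‖ ^ 2 + ‖z.snd‖ ^ 2) * Real.sin_sq_add_cos_sq φ
  let e : WithLp 2 (V × V) ≃ₗᵢ[ℝ] WithLp 2 (V × V) :=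
    (⟨A, hA⟩ : WithLp 2 (V × V) →ₗᵢ[ℝ] WithLp 2 (V × V)).toLinearIsometryEquiv rfl
  exact (WithLp.volume_preserving_ofLp V V).comp
    (e.measurePreserving.comp (WithLp.volume_preserving_toLp V V))

section Refreshment

variable {h : EuclideanSpace ℝ (Fin d) → ℝ}

lemma integrable_mul_gaussDensity_prod (hc : Continuous h) (hs : HasCompactSupport h) :
    Integrable (fun z : EuclideanSpace ℝ (Fin d) × EuclideanSpace ℝ (Fin d) =>
      h z.1 * gaussDensity d z.1 * gaussDensity d z.2) :=
  ((hc.mul continuous_gaussDensity).integrable_of_hasCompactSupport hs.mul_right).mul_prod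
    integrable_gaussDensity

lemma integrable_refresh_prod (hc : Continuous h) (hs : HasCompactSupport h) (φ : ℝ) :
    Integrable (fun z : EuclideanSpace ℝ (Fin d) × EuclideanSpace ℝ (Fin d) =>
      h (Real.cos φ • z.1 + Real.sin φ • z.2) * gaussDensity d z.2 * gaussDensity d z.1) := by
  refine ((measurePreserving_prod_rotation φ).integrable_comp_of_integrable
    (integrable_mul_gaussDensity_prod hc hs)).congr (.of_forall fun z => ?_)
  simp only [Function.comp_apply]
  rw [mul_assoc, gaussDensity_mul_rotation]
  ring

lemma integrable_refresh (hc : Continuous h) (hs : HasCompactSupport h) (φ : ℝ) :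
    Integrable (fun v => (∫ ξ, h (Real.cos φ • v + Real.sin φ • ξ) * gaussDensity d ξ)
      * gaussDensity d v) := by
  simpa only [integral_mul_const] using (integrable_refresh_prod hc hs φ).integral_prod_left

/-- The standard Gaussian is invariant under the refreshment `v ↦ cos φ v + sin φ ξ`. -/
lemma integral_refresh (hc : Continuous h) (hs : HasCompactSupport h) (φ : ℝ) :
    ∫ v, (∫ ξ, h (Real.cos φ • v + Real.sin φ • ξ) * gaussDensity d ξ) * gaussDensity d v
      = ∫ v, h v * gaussDensity d v := by
  have hG := integrable_mul_gaussDensity_prod hc hs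
  have hrot := measurePreserving_prod_rotation (V := EuclideanSpace ℝ (Fin d)) φ
  calc _ = ∫ z : EuclideanSpace ℝ (Fin d) × EuclideanSpace ℝ (Fin d),
        h (Real.cos φ • z.1 + Real.sin φ • z.2)
          * gaussDensity d z.2 * gaussDensity d z.1 := by
        rw [Measure.volume_eq_prod, integral_prod _ (integrable_refresh_prod hc hs φ)]
        simp only [integral_mul_const]
    _ = ∫ z : EuclideanSpace ℝ (Fin d) × EuclideanSpace ℝ (Fin d),
        h z.1 * gaussDensity d z.1 * gaussDensity d z.2 := by
        have key := integral_map (μ := volume) hrot.measurable.aemeasurable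
          (by rw [hrot.map_eq]; exact hG.aestronglyMeasurable)
        rw [hrot.map_eq] at key
        rw [key]
        refine integral_congr_ae (.of_forall fun z => ?_)
        simp only
        rw [mul_assoc (h _) (gaussDensity d (_ + _)), gaussDensity_mul_rotation]
        ring
    _ = _ := by
        rw [Measure.volume_eq_prod, integral_prod_mul (fun v => h v * gaussDensity d v),
          integral_gaussDensity, mul_one]

end Refreshment

lemma integral_fderiv_mul_gaussDensity {h : EuclideanSpace ℝ (Fin d) → ℝ} (hh : ContDiff ℝ 1 h)
    (hs : HasCompactSupport h) (b : EuclideanSpace ℝ (Fin d)) :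
    ∫ v, fderiv ℝ h v b * gaussDensity d v = ∫ v, h v * ⟪v, b⟫_ℝ * gaussDensity d v := by
  have hψ := continuous_gaussDensity (d := d)
  have hdh : Continuous fun v => fderiv ℝ h v b := (hh.continuous_fderiv one_ne_zero).clm_apply
    continuous_const
  have key := integral_mul_fderiv_eq_neg_fderiv_mul_of_integrable (f := h)
    (g := gaussDensity d) (v := b) (μ := volume)
    ((hdh.mul hψ).integrable_of_hasCompactSupport (hs.fderiv_apply (𝕜 := ℝ) b).mul_right)
    ((hh.continuous.mul (((contDiff_gaussDensity (n := 1)).continuous_fderiv one_ne_zero).clm_apply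
      continuous_const)).integrable_of_hasCompactSupport hs.mul_right)
    ((hh.continuous.mul hψ).integrable_of_hasCompactSupport hs.mul_right)
    (fun v _ => (hh.differentiable one_ne_zero).differentiableAt)
    (fun v _ => ((contDiff_gaussDensity (n := 1)).differentiable one_ne_zero).differentiableAt)
  simp only [fderiv_gaussDensity_apply, mul_neg, integral_neg, neg_inj] at key
  rw [← key]
  simp only [mul_assoc]

section Bounce

variable {h : EuclideanSpace ℝ (Fin d) → ℝ}

lemma sub_smul_eq_reflection (n v : EuclideanSpace ℝ (Fin d)) :
    v - (2 * ⟪v, n⟫_ℝ / ‖n‖ ^ 2) • n = (ℝ ∙ n)ᗮ.reflection v := by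
  rw [Submodule.reflection_orthogonal_apply, Submodule.reflection_singleton_apply,
    real_inner_comm]
  simp
  module

lemma integrable_bounce (hc : Continuous h) (hs : HasCompactSupport h)
    (n : EuclideanSpace ℝ (Fin d)) :
    Integrable (fun v => max 0 ⟪v, n⟫_ℝ * (h ((ℝ ∙ n)ᗮ.reflection v) - h v)
      * gaussDensity d v) := by
  have hρ := (ℝ ∙ n)ᗮ.reflection.continuous
  have hψ := continuous_gaussDensity (d := d)
  refine Continuous.integrable_of_hasCompactSupport (by fun_prop) (HasCompactSupport.mul_right
    (HasCompactSupport.mul_left ?_))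
  exact (hs.comp_homeomorph (ℝ ∙ n)ᗮ.reflection.toHomeomorph).sub hs

lemma integral_bounce (hc : Continuous h) (hs : HasCompactSupport h)
    (n : EuclideanSpace ℝ (Fin d)) :
    ∫ v, max 0 ⟪v, n⟫_ℝ * (h ((ℝ ∙ n)ᗮ.reflection v) - h v) * gaussDensity d v
      = -∫ v, h v * ⟪v, n⟫_ℝ * gaussDensity d v := by
  set ρ := (ℝ ∙ n)ᗮ.reflection
  have hψ := continuous_gaussDensity (d := d)
  have hρn (v : EuclideanSpace ℝ (Fin d)) : ⟪ρ v, n⟫_ℝ = -⟪v, n⟫_ℝ := by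
    have hn : ρ n = -n := Submodule.reflection_orthogonalComplement_singleton_eq_neg n
    have := ρ.inner_map_map v n
    rw [hn, inner_neg_right] at this
    linarith
  have hψρ (v : EuclideanSpace ℝ (Fin d)) : gaussDensity d (ρ v) = gaussDensity d v := by
    simp [gaussDensity]
  have hi : Integrable fun v => max 0 ⟪v, n⟫_ℝ * h v * gaussDensity d v :=
    Continuous.integrable_of_hasCompactSupport (by fun_prop) hs.mul_left.mul_right
  have hi' : Integrable fun v => max 0 (-⟪v, n⟫_ℝ) * h v * gaussDensity d v :=
    Continuous.integrable_of_hasCompactSupport (by fun_prop) hs.mul_left.mul_right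
  have hcomp := ρ.measurePreserving.integral_comp ρ.toHomeomorph.measurableEmbedding
    (fun v => max 0 (-⟪v, n⟫_ℝ) * h v * gaussDensity d v)
  have hci := ρ.measurePreserving.integrable_comp_of_integrable hi'
  simp only [Function.comp_def, hρn, neg_neg, hψρ] at hcomp hci
  simp only [mul_sub, sub_mul]
  rw [integral_sub hci hi, hcomp, ← integral_sub hi' hi, ← integral_neg]
  refine integral_congr_ae (.of_forall fun v => ?_)
  simp only
  have : max 0 (-⟪v, n⟫_ℝ) - max 0 ⟪v, n⟫_ℝ = -⟪v, n⟫_ℝ := by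
    rcases le_total 0 ⟪v, n⟫_ℝ with h0 | h0 <;> simp [h0]
  linear_combination (h v * gaussDensity d v) * this

end Bounce

/-- The velocity part of the generator, integrated against the Gaussian, reduces to the
contribution of the drift `b - n`. -/
lemma integral_velocity_generator {h a : EuclideanSpace ℝ (Fin d) → ℝ} (hh : ContDiff ℝ 1 h)
    (hs : HasCompactSupport h) (ha : Continuous a) (has : HasCompactSupport a)
    (n w : EuclideanSpace ℝ (Fin d)) (lam φ : ℝ) :
    ∫ v, (a v + fderiv ℝ h v (-w + n)
        + max 0 ⟪v, n⟫_ℝ * (h ((ℝ ∙ n)ᗮ.reflection v) - h v)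
        + lam * ((∫ ξ, h (Real.cos φ • v + Real.sin φ • ξ) * gaussDensity d ξ) - h v))
        * gaussDensity d v
      = ∫ v, (a v - h v * ⟪v, w⟫_ℝ) * gaussDensity d v := by
  have hψ := continuous_gaussDensity (d := d)
  have hc := hh.continuous
  have ia : Integrable fun v => a v * gaussDensity d v :=
    (ha.mul hψ).integrable_of_hasCompactSupport has.mul_right
  have ih : Integrable fun v => h v * gaussDensity d v :=
    (hc.mul hψ).integrable_of_hasCompactSupport hs.mul_right
  have iin (b : EuclideanSpace ℝ (Fin d)) : Integrable fun v => h v * ⟪v, b⟫_ℝ * gaussDensity d v :=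
    Continuous.integrable_of_hasCompactSupport (by fun_prop) hs.mul_right.mul_right
  have id' : Integrable fun v => fderiv ℝ h v (-w + n) * gaussDensity d v :=
    (((hh.continuous_fderiv one_ne_zero).clm_apply continuous_const).mul
      hψ).integrable_of_hasCompactSupport (hs.fderiv_apply (𝕜 := ℝ) _).mul_right
  have ib := integrable_bounce hc hs n
  have ir := integrable_refresh hc hs φ
  simp only [add_mul, sub_mul, mul_assoc lam, mul_sub lam]
  rw [integral_add ((ia.fun_add id').fun_add ib) ((ir.const_mul lam).sub' (ih.const_mul lam)),
    integral_add (ia.fun_add id') ib, integral_add ia id', integral_fderiv_mul_gaussDensity hh hs,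
    integral_bounce hc hs, integral_sub (ir.const_mul lam) (ih.const_mul lam),
    integral_const_mul, integral_const_mul, integral_refresh hc hs, integral_sub ia (iin w)]
  simp only [inner_add_right, inner_neg_right, mul_add, add_mul, mul_neg, neg_mul]
  rw [integral_add (iin w).fun_neg (iin n), integral_neg]
  ring

end GaussDensity

/-- A `C¹` compactly supported density is preserved on average by free transport. -/
lemma integral_integral_transport {V : Type*} [NormedAddCommGroup V] [NormedSpace ℝ V]
    [FiniteDimensional ℝ V] [MeasurableSpace V] [BorelSpace V] (μ : Measure V)
    [μ.IsAddHaarMeasure] {F : V × V → ℝ} (hF : ContDiff ℝ 1 F) (hFs : HasCompactSupport F)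
    {ψ : V → ℝ} (hψ : Continuous ψ) :
    ∫ x, ∫ v, fderiv ℝ F (x, v) (v, 0) * ψ v ∂μ ∂μ = 0 := by
  have hdc : Continuous fun z : V × V => fderiv ℝ F z (z.2, 0) :=
    (hF.continuous_fderiv one_ne_zero).clm_apply (by fun_prop)
  have hds : HasCompactSupport fun z : V × V => fderiv ℝ F z (z.2, 0) :=
    (hFs.fderiv (𝕜 := ℝ)).mono fun z hz hz0 => hz (by simp [hz0])
  have hint : Integrable (fun z : V × V => fderiv ℝ F z (z.2, 0) * ψ z.2) (μ.prod μ) :=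
    Continuous.integrable_of_hasCompactSupport (by fun_prop) hds.mul_right
  rw [integral_integral_swap hint]
  refine integral_eq_zero_of_ae (.of_forall fun v => ?_)
  simp only [integral_mul_const, Pi.zero_apply]
  have hline : ContDiff ℝ 1 fun x => F (x, v) := hF.comp (by fun_prop)
  have hlines : HasCompactSupport fun x => F (x, v) :=
    hFs.comp_of_leftInverse continuous_fst fun _ => rfl
  have hfd (x : V) : fderiv ℝ F (x, v) (v, 0) = fderiv ℝ (fun y => F (y, v)) x v := by
    have h1 : HasFDerivAt (fun y => F (y, v)) _ x :=
      (hF.differentiable one_ne_zero (x, v)).hasFDerivAt.comp x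
      (hasFDerivAt_prodMk_left (𝕜 := ℝ) x v)
    rw [h1.fderiv]
    simp
  simp only [hfd]
  have hi : Integrable (fun x => fderiv ℝ (fun y => F (y, v)) x v) μ :=
    ((hline.continuous_fderiv one_ne_zero).clm_apply
      continuous_const).integrable_of_hasCompactSupport (hlines.fderiv_apply (𝕜 := ℝ) v)
  have key := integral_mul_fderiv_eq_neg_fderiv_mul_of_integrable (f := fun _ : V => (1 : ℝ))
    (g := fun y => F (y, v)) (v := v) (μ := μ) (by simp) (by simpa using hi)
    (by simpa using hline.continuous.integrable_of_hasCompactSupport hlines)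
    (fun x _ => by fun_prop) (fun x _ => hline.differentiable one_ne_zero x)
  simp only [one_mul, fderiv_fun_const, Pi.zero_apply, _root_.zero_apply, zero_mul,
    integral_zero, neg_zero] at key
  rw [key, zero_mul]

/-- Invariance of the Bouncy Hybrid Sampler with generalized refreshment
`v ↦ cos(φ) v + sin(φ) ξ`: the integral of the infinitesimal generator against
`ρ(x,v) ∝ e^{-U(x)} ψ_d(v)` vanishes. -/
theorem stmt_9 {d : ℕ} (U : EuclideanSpace ℝ (Fin d) → ℝ) (hU : ContDiff ℝ 1 U)
    (hUint : Integrable (fun x => Real.exp (-U x)))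
    (g : EuclideanSpace ℝ (Fin d) → EuclideanSpace ℝ (Fin d)) (hg : Continuous g)
    (hg0 : ∀ x, g x ≠ 0)
    (lam0 : ℝ) (hlam0 : 0 ≤ lam0)
    (phi : ℝ) (hphi : phi ∈ Set.Ioc 0 (Real.pi / 2))
    (R : EuclideanSpace ℝ (Fin d) → EuclideanSpace ℝ (Fin d) → EuclideanSpace ℝ (Fin d))
    (hR : ∀ x v, R x v = v - (2 * ⟪v, g x⟫_ℝ / ‖g x‖ ^ 2) • g x)
    (f : EuclideanSpace ℝ (Fin d) × EuclideanSpace ℝ (Fin d) → ℝ)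
    (hf : ContDiff ℝ (⊤ : ℕ∞) f) (hfc : HasCompactSupport f) :
    ∫ x, ∫ v,
        (⟪gradient (fun y => f (y, v)) x, v⟫_ℝ
          + ⟪gradient (fun w => f (x, w)) v, -gradient U x + g x⟫_ℝ
          + max 0 ⟪v, g x⟫_ℝ * (f (x, R x v) - f (x, v))
          + lam0 * ((∫ ξ, f (x, Real.cos phi • v + Real.sin phi • ξ)
              * gaussDensity d ξ) - f (x, v)))
        * (Real.exp (-U x) * gaussDensity d v) = 0 := by
  have hf1 : ContDiff ℝ 1 f := hf.of_le (by exact_mod_cast le_top)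
  have hψ := continuous_gaussDensity (d := d)
  let F : EuclideanSpace ℝ (Fin d) × EuclideanSpace ℝ (Fin d) → ℝ :=
    fun z => f z * Real.exp (-U z.1)
  have hF : ContDiff ℝ 1 F := hf1.mul (Real.contDiff_exp.comp (hU.comp contDiff_fst).neg)
  have hFs : HasCompactSupport F := hfc.mul_right
  refine (integral_congr_ae (.of_forall fun x => ?_)).trans
    (integral_integral_transport volume hF hFs hψ)
  have hh : ContDiff ℝ 1 fun v => f (x, v) := hf1.comp (by fun_prop)
  have hs : HasCompactSupport fun v => f (x, v) :=
    hfc.comp_of_leftInverse continuous_snd fun _ => rfl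
  have hfx (v) : HasFDerivAt (fun y => f (y, v)) _ x :=
    (hf1.differentiable one_ne_zero (x, v)).hasFDerivAt.comp x (hasFDerivAt_prodMk_left x v)
  have hUd := hU.differentiable one_ne_zero
  have hFx (v) : fderiv ℝ F (x, v) (v, 0)
      = Real.exp (-U x) * (fderiv ℝ f (x, v) (v, 0) - f (x, v) * ⟪v, gradient U x⟫_ℝ) := by
    have hU' : HasFDerivAt (fun z : EuclideanSpace ℝ (Fin d) × EuclideanSpace ℝ (Fin d) =>
        U z.1) _ (x, v) := (hUd x).hasFDerivAt.comp (x, v) hasFDerivAt_fst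
    have h2 : HasFDerivAt F _ (x, v) :=
      (hf1.differentiable one_ne_zero (x, v)).hasFDerivAt.mul hU'.neg.exp
    rw [h2.fderiv, inner_gradient_right]
    simp
    ring
  have hfs : HasCompactSupport fun v => fderiv ℝ f (x, v) (v, 0) :=
    ((hfc.fderiv (𝕜 := ℝ)).comp_of_leftInverse (i := fun v => (x, v)) continuous_snd
      fun _ => rfl).mono fun v hv hv0 => hv (by simp [hv0])
  have key := integral_velocity_generator (a := fun v => fderiv ℝ f (x, v) (v, 0)) hh hs
    ((hf1.continuous_fderiv one_ne_zero).comp (by fun_prop : Continuous fun v => (x, v))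
      |>.clm_apply (by fun_prop)) hfs (g x) (gradient U x) lam0 phi
  simp only [hFx, mul_assoc (Real.exp (-U x)), integral_const_mul]
  rw [← key, ← integral_const_mul]
  refine integral_congr_ae (.of_forall fun v => ?_)
  simp only
  rw [hR, sub_smul_eq_reflection, inner_gradient_left, (hfx v).fderiv,
    inner_gradient_left]
  simp only [ContinuousLinearMap.comp_apply, ContinuousLinearMap.inl_apply]
  ring
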